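/- arXiv:2010.13289 — 5 statements merged into one kernel-verified Lean document; each statement's English description precedes it below -/
import Mathlib

section
/- Let Δx > 0, x_m = m·Δx, and let h : ℝ → ℝ be a polynomial of degree at most 2. Let f_m = (1/Δx)·∫_{x_m−Δx/2}^{x_m+Δx/2} h(ξ) dξ denote the cell average of h over cell m. Then for every integer i, −(1/6)·f_{i−1} + (5/6)·f_i + (2/6)·f_{i+1} = h(x_i + Δx/2). (Exactness of the candidate stencil flux k = 0 of Table 1.) -/
theorem integral_quadratic (a b c u v : ℝ) :
    ∫ x in u..v, (a * x ^ 2 + b * x + c) =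
      a * ((v ^ 3 - u ^ 3) / 3) + b * ((v ^ 2 - u ^ 2) / 2) + c * (v - u) := by
  rw [intervalIntegral.integral_add, intervalIntegral.integral_add,
    intervalIntegral.integral_const_mul, intervalIntegral.integral_const_mul,
    integral_pow, integral_id, intervalIntegral.integral_const, smul_eq_mul]
  · norm_num
    ring
  all_goals exact Continuous.intervalIntegrable (by fun_prop) _ _

/-- Exactness of a candidate stencil flux of Table 1: for a polynomial of
degree at most 2, the stencil combination of cell averages recovers the
point value of the polynomial at the cell interface `x_i + Δx/2`. -/
theorem stencil_k0_exact (Δx : ℝ) (hΔx : 0 < Δx) (h : Polynomial ℝ)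
    (hdeg : h.degree ≤ 2)
    (f : ℤ → ℝ)
    (hf : ∀ m : ℤ, f m =
      (1 / Δx) * ∫ ξ in ((m : ℝ) * Δx - Δx / 2)..((m : ℝ) * Δx + Δx / 2), h.eval ξ)
    (i : ℤ) :
    -(1 / 6) * f (i - 1) + (5 / 6) * f i + (2 / 6) * f (i + 1) = h.eval ((i : ℝ) * Δx + Δx / 2) := by
  have heval (x : ℝ) : h.eval x = h.coeff 2 * x ^ 2 + h.coeff 1 * x + h.coeff 0 := by
    conv_lhs => rw [Polynomial.eq_quadratic_of_degree_le_two hdeg]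
    simp
  simp only [hf, heval, integral_quadratic]
  push_cast
  field_simp
  ring
end

section
/- Let Δx > 0, x_m = m·Δx, and let h : ℝ → ℝ be a polynomial of degree at most 3. Let f_m = (1/Δx)·∫_{x_m−Δx/2}^{x_m+Δx/2} h(ξ) dξ denote the cell average of h over cell m. Then for every integer i, (3/12)·f_i + (13/12)·f_{i+1} − (5/12)·f_{i+2} + (1/12)·f_{i+3} = h(x_i + Δx/2). (Exactness of the candidate stencil flux k = 3 of Table 1.) -/
theorem integral_cubic (c₀ c₁ c₂ c₃ a b : ℝ) :
    ∫ x in a..b, (c₀ + c₁ * x + c₂ * x ^ 2 + c₃ * x ^ 3) =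
      c₀ * (b - a) + c₁ * ((b ^ 2 - a ^ 2) / 2) + c₂ * ((b ^ 3 - a ^ 3) / 3) +
        c₃ * ((b ^ 4 - a ^ 4) / 4) := by
  have hderiv (x : ℝ) : HasDerivAt
      (fun y : ℝ => c₀ * y + c₁ / 2 * y ^ 2 + c₂ / 3 * y ^ 3 + c₃ / 4 * y ^ 4)
      (c₀ + c₁ * x + c₂ * x ^ 2 + c₃ * x ^ 3) x := by
    refine HasDerivAt.congr_deriv (((((hasDerivAt_id x).const_mul c₀).add
      ((hasDerivAt_pow 2 x).const_mul (c₁ / 2))).add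
        ((hasDerivAt_pow 3 x).const_mul (c₂ / 3))).add
          ((hasDerivAt_pow 4 x).const_mul (c₃ / 4))) ?_
    norm_num
    ring
  rw [intervalIntegral.integral_eq_sub_of_hasDerivAt (fun x _ => hderiv x)
    (Continuous.intervalIntegrable (by fun_prop) a b)]
  ring

/-- Exactness of a candidate stencil flux of Table 1: for a polynomial of
degree at most 3, the stencil combination of cell averages recovers the
point value of the polynomial at the cell interface `x_i + Δx/2`. -/
theorem stencil_k3_exact (Δx : ℝ) (hΔx : 0 < Δx) (h : Polynomial ℝ)
    (hdeg : h.degree ≤ 3)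
    (f : ℤ → ℝ)
    (hf : ∀ m : ℤ, f m =
      (1 / Δx) * ∫ ξ in ((m : ℝ) * Δx - Δx / 2)..((m : ℝ) * Δx + Δx / 2), h.eval ξ)
    (i : ℤ) :
    (3 / 12) * f i + (13 / 12) * f (i + 1) - (5 / 12) * f (i + 2) + (1 / 12) * f (i + 3) = h.eval ((i : ℝ) * Δx + Δx / 2) := by
  have heval (x : ℝ) : h.eval x =
      h.coeff 0 + h.coeff 1 * x + h.coeff 2 * x ^ 2 + h.coeff 3 * x ^ 3 := by
    have hnat : h.natDegree < 4 :=
      Nat.lt_succ_of_le (Polynomial.natDegree_le_of_degree_le hdeg)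
    simp [Polynomial.eval_eq_sum_range' hnat, Finset.sum_range_succ]
  simp only [hf, heval, integral_cubic]
  push_cast
  field_simp
  ring
end

section
/- Let Δx > 0, x_m = m·Δx, and let h : ℝ → ℝ be a polynomial of degree at most 3. Let f_m = (1/Δx)·∫_{x_m−Δx/2}^{x_m+Δx/2} h(ξ) dξ denote the cell average of h over cell m. Then for every integer i, −(3/12)·f_{i−3} + (13/12)·f_{i−2} − (23/12)·f_{i−1} + (25/12)·f_i = h(x_i + Δx/2). (Exactness of the candidate stencil flux k = 4 of Table 1.) -/
/-- The interval integral of a polynomial, in terms of its coefficients. -/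
theorem Polynomial.integral_eval_eq_sum_range {p : Polynomial ℝ} {n : ℕ}
    (hn : p.natDegree < n) (a b : ℝ) :
    ∫ x in a..b, p.eval x =
      ∑ k ∈ Finset.range n, p.coeff k * ((b ^ (k + 1) - a ^ (k + 1)) / (k + 1)) := by
  simp_rw [Polynomial.eval_eq_sum_range' hn]
  rw [intervalIntegral.integral_finsetSum fun k _ =>
    (Continuous.intervalIntegrable (by fun_prop) a b)]
  simp only [intervalIntegral.integral_const_mul, integral_pow]

/-- Exactness of a candidate stencil flux of Table 1: for a polynomial of
degree at most 3, the stencil combination of cell averages recovers the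
point value of the polynomial at the cell interface `x_i + Δx/2`. -/
theorem stencil_k4_exact (Δx : ℝ) (hΔx : 0 < Δx) (h : Polynomial ℝ)
    (hdeg : h.degree ≤ 3)
    (f : ℤ → ℝ)
    (hf : ∀ m : ℤ, f m =
      (1 / Δx) * ∫ ξ in ((m : ℝ) * Δx - Δx / 2)..((m : ℝ) * Δx + Δx / 2), h.eval ξ)
    (i : ℤ) :
    -(3 / 12) * f (i - 3) + (13 / 12) * f (i - 2) - (23 / 12) * f (i - 1) + (25 / 12) * f i = h.eval ((i : ℝ) * Δx + Δx / 2) := by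
  have hn : h.natDegree < 4 :=
    Nat.lt_succ_of_le (Polynomial.natDegree_le_of_degree_le hdeg)
  simp only [hf, Polynomial.integral_eval_eq_sum_range hn]
  simp only [Polynomial.eval_eq_sum_range' hn,
    Finset.sum_range_succ, Finset.sum_range_zero]
  push_cast
  field_simp
  ring
end

section
/- Let Δx > 0, x_m = m·Δx, and let h : ℝ → ℝ be a polynomial of degree at most 4. Let f_m = (1/Δx)·∫_{x_m−Δx/2}^{x_m+Δx/2} h(ξ) dξ denote the cell average of h over cell m. Then for every integer i, (12/60)·f_i + (77/60)·f_{i+1} − (43/60)·f_{i+2} + (17/60)·f_{i+3} − (3/60)·f_{i+4} = h(x_i + Δx/2). (Exactness of the candidate stencil flux k = 5 of Table 1.) -/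
theorem Polynomial.intervalIntegral_eval_of_natDegree_lt (p : Polynomial ℝ) {n : ℕ}
    (hp : p.natDegree < n) (a b : ℝ) :
    ∫ x in a..b, p.eval x =
      ∑ k ∈ Finset.range n, p.coeff k * ((b ^ (k + 1) - a ^ (k + 1)) / (k + 1)) := by
  simp_rw [Polynomial.eval_eq_sum_range' hp]
  rw [intervalIntegral.integral_finsetSum fun k _ =>
    Continuous.intervalIntegrable (by fun_prop) a b]
  simp [integral_pow]

/-- Exactness of a candidate stencil flux of Table 1: for a polynomial of
degree at most 4, the stencil combination of cell averages recovers the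
point value of the polynomial at the cell interface `x_i + Δx/2`. -/
theorem stencil_k5_exact (Δx : ℝ) (hΔx : 0 < Δx) (h : Polynomial ℝ)
    (hdeg : h.degree ≤ 4)
    (f : ℤ → ℝ)
    (hf : ∀ m : ℤ, f m =
      (1 / Δx) * ∫ ξ in ((m : ℝ) * Δx - Δx / 2)..((m : ℝ) * Δx + Δx / 2), h.eval ξ)
    (i : ℤ) :
    (12 / 60) * f i + (77 / 60) * f (i + 1) - (43 / 60) * f (i + 2) + (17 / 60) * f (i + 3) - (3 / 60) * f (i + 4) = h.eval ((i : ℝ) * Δx + Δx / 2) := by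
  have hn : h.natDegree < 5 := Nat.lt_succ_of_le (Polynomial.natDegree_le_of_degree_le hdeg)
  simp only [hf, Polynomial.intervalIntegral_eval_of_natDegree_lt h hn]
  simp only [Polynomial.eval_eq_sum_range' hn, Finset.sum_range_succ, Finset.sum_range_zero]
  push_cast
  field_simp
  ring
end

section
/- Let Δx > 0, x_m = m·Δx, and let h : ℝ → ℝ be a polynomial of degree at most 4. Let f_m = (1/Δx)·∫_{x_m−Δx/2}^{x_m+Δx/2} h(ξ) dξ denote the cell average of h over cell m. Then for every integer i, (2·f_{i−2} − 13·f_{i−1} + 47·f_i + 27·f_{i+1} − 3·f_{i+2})/60 = h(x_i + Δx/2). (Exactness of the linear fifth-order upwind interface flux on the five-cell stencil {i−2, …, i+2}, which the unlimited fifth-order TVD reconstruction recovers.) -/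
theorem Polynomial.eval_eq_of_degree_le_four {R : Type*} [CommSemiring R] {p : Polynomial R}
    (hp : p.degree ≤ 4) (x : R) :
    p.eval x = p.coeff 0 + p.coeff 1 * x + p.coeff 2 * x ^ 2 + p.coeff 3 * x ^ 3
      + p.coeff 4 * x ^ 4 := by
  have hlt : p.natDegree < 5 := Nat.lt_succ_of_le (Polynomial.natDegree_le_of_degree_le hp)
  rw [Polynomial.eval_eq_sum_range' hlt]
  simp [Finset.sum_range_succ]

theorem Polynomial.integral_eval_of_degree_le_four {p : Polynomial ℝ} (hp : p.degree ≤ 4)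
    (a b : ℝ) :
    ∫ x in a..b, p.eval x =
      p.coeff 0 * (b - a) + p.coeff 1 * ((b ^ 2 - a ^ 2) / 2) + p.coeff 2 * ((b ^ 3 - a ^ 3) / 3)
        + p.coeff 3 * ((b ^ 4 - a ^ 4) / 4) + p.coeff 4 * ((b ^ 5 - a ^ 5) / 5) := by
  have hderiv : ∀ x ∈ Set.uIcc a b, HasDerivAt
      (fun y : ℝ => p.coeff 0 * y + p.coeff 1 * (y ^ 2 / 2) + p.coeff 2 * (y ^ 3 / 3)
        + p.coeff 3 * (y ^ 4 / 4) + p.coeff 4 * (y ^ 5 / 5)) (p.eval x) x := by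
    intro x _
    rw [p.eval_eq_of_degree_le_four hp]
    have hpow (n : ℕ) (d c : ℝ) := ((hasDerivAt_pow n x).div_const d).const_mul c
    have hsum := (((((hasDerivAt_id x).const_mul (p.coeff 0)).add (hpow 2 2 (p.coeff 1))).add
      (hpow 3 3 (p.coeff 2))).add (hpow 4 4 (p.coeff 3))).add (hpow 5 5 (p.coeff 4))
    refine hsum.congr_deriv ?_
    norm_num
  rw [intervalIntegral.integral_eq_sub_of_hasDerivAt hderiv (p.continuous.intervalIntegrable a b)]
  ring

/-- Exactness of a candidate stencil flux of Table 1: for a polynomial of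
degree at most 4, the stencil combination of cell averages recovers the
point value of the polynomial at the cell interface `x_i + Δx/2`. -/
theorem upwind5_exact (Δx : ℝ) (hΔx : 0 < Δx) (h : Polynomial ℝ)
    (hdeg : h.degree ≤ 4)
    (f : ℤ → ℝ)
    (hf : ∀ m : ℤ, f m =
      (1 / Δx) * ∫ ξ in ((m : ℝ) * Δx - Δx / 2)..((m : ℝ) * Δx + Δx / 2), h.eval ξ)
    (i : ℤ) :
    (2 * f (i - 2) - 13 * f (i - 1) + 47 * f i + 27 * f (i + 1) - 3 * f (i + 2)) / 60 = h.eval ((i : ℝ) * Δx + Δx / 2) := by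
  simp only [hf, Polynomial.integral_eval_of_degree_le_four hdeg]
  rw [Polynomial.eval_eq_of_degree_le_four hdeg]
  push_cast
  field_simp
  ring
end
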